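/- arXiv:2412.01777 — 2 statements merged into one kernel-verified Lean document; each statement's English description precedes it below -/
import Mathlib

section
/- Let n ≥ 1 and let H : ℝ × ℝ^{2n} → ℝ be smooth, 1-periodic in the first variable, with H(t,·) convex for every t and satisfying D²_zH(t,z)[v,v] ≥ ĥ‖v‖² for some ĥ > 0 and all t,z,v. Let γ : ℝ → ℝ^{2n} be a smooth 1-periodic solution of γ'(t) = J₀∇H(t,γ(t)). Then the Clarke dual action of γ equals its Hamiltonian action: −½∫₀¹ ω₀(γ(t),γ'(t)) dt + ∫₀¹ H*(t, −J₀γ'(t)) dt = ½∫₀¹ ω₀(γ(t),γ'(t)) dt − ∫₀¹ H(t,γ(t)) dt, where H*(t,w) := sup_{z ∈ ℝ^{2n}} (⟨z,w⟩ − H(t,z)) is the Fenchel conjugate (finite by the quadratic convexity assumption). -/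
open Metric Set
open scoped InnerProductSpace

noncomputable section

/-- The standard complex structure `J₀(x₁,y₁,…,xₙ,yₙ) = (−y₁,x₁,…,−yₙ,xₙ)` on `ℝ^{2n}`. -/
def J0 (n : ℕ) (z : EuclideanSpace ℝ (Fin (2 * n))) : EuclideanSpace ℝ (Fin (2 * n)) :=
  WithLp.toLp 2 fun i =>
    if h : (i : ℕ) % 2 = 0 then -z ⟨(i : ℕ) + 1, by have := i.isLt; omega⟩
    else z ⟨(i : ℕ) - 1, by have := i.isLt; omega⟩

/-- The standard symplectic form `ω₀(u,v) = ⟨J₀u, v⟩` on `ℝ^{2n}`. -/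
def omega0 (n : ℕ) (u v : EuclideanSpace ℝ (Fin (2 * n))) : ℝ := ⟪J0 n u, v⟫_ℝ

end

theorem J0_skew (n : ℕ) (u v : EuclideanSpace ℝ (Fin (2 * n))) :
    ⟪J0 n u, v⟫_ℝ = -⟪u, J0 n v⟫_ℝ := by
  let s : Fin (2 * n) → Fin (2 * n) := fun i =>
    if h : (i : ℕ) % 2 = 0 then ⟨(i : ℕ) + 1, by have := i.isLt; omega⟩
    else ⟨(i : ℕ) - 1, by have := i.isLt; omega⟩
  have hs : Function.Involutive s := by
    intro i
    apply Fin.ext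
    by_cases h : (i : ℕ) % 2 = 0
    · have h2 : ¬ ((i : ℕ) + 1) % 2 = 0 := by omega
      simp [s, h, h2]
    · have h2 : ((i : ℕ) - 1) % 2 = 0 := by omega
      simp [s, h, h2]
      omega
  simp only [PiLp.inner_apply, ← Finset.sum_neg_distrib]
  refine Fintype.sum_equiv hs.toPerm _ _ ?_
  intro i
  by_cases h : (i : ℕ) % 2 = 0
  · have h2 : ¬ ((i : ℕ) + 1) % 2 = 0 := by omega
    simp [J0, s, h, h2]
  · have h2 : ((i : ℕ) - 1) % 2 = 0 := by omega
    have h3 : (i : ℕ) - 1 + 1 = i := by omega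
    simp [J0, s, h, h2, h3]

theorem J0_J0 (n : ℕ) (u : EuclideanSpace ℝ (Fin (2 * n))) : J0 n (J0 n u) = -u := by
  ext i
  by_cases h : (i : ℕ) % 2 = 0
  · have h2 : ¬ ((i : ℕ) + 1) % 2 = 0 := by omega
    simp [J0, h, h2]
  · have h2 : ((i : ℕ) - 1) % 2 = 0 := by omega
    have h3 : (i : ℕ) - 1 + 1 = i := by omega
    simp [J0, h, h2, h3]

theorem J0_continuous (n : ℕ) : Continuous (J0 n) := by
  unfold J0
  refine (PiLp.continuous_toLp 2 _).comp (continuous_pi fun i => ?_)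
  split_ifs <;> fun_prop

theorem convex_grad {E : Type*} [NormedAddCommGroup E] [InnerProductSpace ℝ E] [CompleteSpace E]
    (f : E → ℝ) (hf : ConvexOn ℝ Set.univ f) (x z : E) (hd : DifferentiableAt ℝ f x) :
    ⟪z, gradient f x⟫_ℝ - f z ≤ ⟪x, gradient f x⟫_ℝ - f x := by
  have hg := hd.hasGradientAt.hasFDerivAt
  have hl : HasDerivAt (fun t : ℝ => AffineMap.lineMap x z t) (z - x) 0 :=
    AffineMap.hasDerivAt_lineMap
  have hc : ConvexOn ℝ Set.univ (f ∘ (AffineMap.lineMap x z : ℝ →ᵃ[ℝ] E)) := by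
    simpa using hf.comp_affineMap (AffineMap.lineMap x z : ℝ →ᵃ[ℝ] E)
  have hx : (AffineMap.lineMap x z : ℝ →ᵃ[ℝ] E) 0 = x := by simp
  rw [← hx] at hg
  have hcomp := hg.comp_hasDerivAt (0 : ℝ) hl
  have := hc.le_slope_of_hasDerivAt (mem_univ 0) (mem_univ 1) one_pos hcomp
  rw [InnerProductSpace.toDual_apply_apply, inner_sub_right, hx] at this
  simp only [slope_def_field, Function.comp, AffineMap.lineMap_apply_zero,
    AffineMap.lineMap_apply_one, sub_zero, div_one] at this
  rw [real_inner_comm, real_inner_comm _ x]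
  linarith

/-- For a quadratically convex time-periodic Hamiltonian, the Clarke dual action of a
1-periodic orbit equals its Hamiltonian action.  Here the Fenchel conjugate in the spatial
variable is `H*(t,w) = ⨆ z, (⟨z,w⟩ − H t z)`. -/
theorem stmt8 (n : ℕ) (hn : 1 ≤ n)
    (H : ℝ → EuclideanSpace ℝ (Fin (2 * n)) → ℝ)
    (hsmooth : ContDiff ℝ (⊤ : ℕ∞) (fun p : ℝ × EuclideanSpace ℝ (Fin (2 * n)) => H p.1 p.2))
    (hper : ∀ t z, H (t + 1) z = H t z)
    (hconv : ∀ t, ConvexOn ℝ Set.univ (H t))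
    (hquad : ∃ hh : ℝ, 0 < hh ∧
      ∀ t z v, hh * ‖v‖ ^ 2 ≤ iteratedFDeriv ℝ 2 (H t) z ![v, v])
    (γ : ℝ → EuclideanSpace ℝ (Fin (2 * n)))
    (hγsm : ContDiff ℝ (⊤ : ℕ∞) γ)
    (hγsol : ∀ t, HasDerivAt γ (J0 n (gradient (H t) (γ t))) t)
    (hγper : Function.Periodic γ 1) :
    -(1 / 2) * (∫ t in (0 : ℝ)..1, omega0 n (γ t) (deriv γ t)) +
        (∫ t in (0 : ℝ)..1, ⨆ z, (⟪z, -(J0 n (deriv γ t))⟫_ℝ - H t z)) =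
      (1 / 2) * (∫ t in (0 : ℝ)..1, omega0 n (γ t) (deriv γ t)) -
        (∫ t in (0 : ℝ)..1, H t (γ t)) := by
  have hH : ∀ t, Differentiable ℝ (H t) := fun t =>
    (hsmooth.differentiable (by simp)).comp
      (f := fun z : EuclideanSpace ℝ (Fin (2 * n)) => (t, z)) (by fun_prop)
  have key : ∀ t, (⨆ z, (⟪z, -(J0 n (deriv γ t))⟫_ℝ - H t z)) =
      omega0 n (γ t) (deriv γ t) - H t (γ t) := by
    intro t
    have hw : -(J0 n (deriv γ t)) = gradient (H t) (γ t) := by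
      rw [(hγsol t).deriv, J0_J0, neg_neg]
    have ho : omega0 n (γ t) (deriv γ t) = ⟪γ t, gradient (H t) (γ t)⟫_ℝ := by
      rw [omega0, J0_skew, ← inner_neg_right, hw]
    rw [hw, ho]
    have hle := fun z => convex_grad (H t) (hconv t) (γ t) z (hH t _)
    apply le_antisymm
    · exact ciSup_le hle
    · exact le_ciSup (f := fun z => ⟪z, gradient (H t) (γ t)⟫_ℝ - H t z)
        ⟨_, by rintro _ ⟨z, rfl⟩; exact hle z⟩ (γ t)
  have hc1 : Continuous fun t => omega0 n (γ t) (deriv γ t) := by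
    unfold omega0
    exact ((J0_continuous n).comp hγsm.continuous).inner (hγsm.continuous_deriv (by simp))
  have hc2 : Continuous fun t => H t (γ t) :=
    hsmooth.continuous.comp (continuous_id.prodMk hγsm.continuous)
  simp_rw [key]
  rw [intervalIntegral.integral_sub (hc1.intervalIntegrable _ _) (hc2.intervalIntegrable _ _)]
  ring
end

section
/- Let n ≥ 1 and let H : ℝ × ℂⁿ → ℝ be smooth, 1-periodic in the first variable, and quadratically convex: there are constants 0 < ĥ ≤ h̄ with ĥ‖v‖² ≤ D²_zH(t,z)[v,v] ≤ h̄‖v‖² for all t,z,v. Let β : ℝ/ℤ → ℂⁿ be absolutely continuous with derivative β' ∈ L², and let η ∈ L²(ℝ/ℤ,ℂⁿ) satisfy η̂(k) = 0 for every k ≥ 1 and Σ_{k ≤ −1} |k|·|η̂(k)|² < ∞. Set γ := β + η. Then (with all appearing series converging absolutely) the Hamiltonian action of γ is controlled by the Clarke dual action of β: π·Σ_{k∈ℤ} k·|γ̂(k)|² − ∫₀¹ H(t,γ(t)) dt ≤ −π·Σ_{k∈ℤ} k·|β̂(k)|² + ∫₀¹ H*(t, −i·β'(t)) dt − π·Σ_{k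 ≤ −1} |k|·|η̂(k)|², where H*(t,w) := sup_{z ∈ ℂⁿ}(Re⟨z,w⟩ − H(t,z)). -/
open Metric Set MeasureTheory
open scoped InnerProductSpace

noncomputable section

/-- The `k`-th Fourier coefficient `f̂(k) = ∫₀¹ e^{−2πikt}·f(t) dt` of a 1-periodic
loop `f : ℝ → ℂⁿ`. -/
def fcoef (n : ℕ) (f : ℝ → EuclideanSpace ℂ (Fin n)) (k : ℤ) : EuclideanSpace ℂ (Fin n) :=
  ∫ t in (0 : ℝ)..1, Complex.exp (-(2 * Real.pi * k * t : ℝ) * Complex.I) • f t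

end


/-- the character -/
noncomputable def chr (k : ℤ) (t : ℝ) : ℂ := Complex.exp (-(2 * Real.pi * k * t : ℝ) * Complex.I)

lemma chr_cont (k : ℤ) : Continuous (chr k) := by
  unfold chr; fun_prop

lemma chr_deriv (k : ℤ) (t : ℝ) :
    HasDerivAt (chr k) (-(2 * Real.pi * k * Complex.I) * chr k t) t := by
  have h : HasDerivAt (fun t : ℝ => (-(2 * Real.pi * k * t : ℝ) * Complex.I : ℂ))
      (-(2 * Real.pi * k * Complex.I)) t := by
    have h0 : HasDerivAt (fun t : ℝ => (t : ℂ)) 1 t := Complex.ofRealCLM.hasDerivAt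
    have := (h0.const_mul (-(2 * Real.pi * k * Complex.I) : ℂ))
    rw [mul_one] at this
    have e : (fun t : ℝ => (-(2 * Real.pi * k * t : ℝ) * Complex.I : ℂ)) =
        fun y : ℝ => -(2 * Real.pi * k * Complex.I : ℂ) * (y : ℂ) := by
      ext s; push_cast; ring
    rw [e]; exact this
  have := h.cexp
  unfold chr
  convert this using 1
  ring

lemma chr_zero (k : ℤ) : chr k 0 = 1 := by simp [chr]

lemma chr_one (k : ℤ) : chr k 1 = 1 := by
  unfold chr
  rw [Complex.exp_eq_one_iff]
  exact ⟨-k, by push_cast; ring⟩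

lemma fcoef_eq (n : ℕ) (f : ℝ → EuclideanSpace ℂ (Fin n)) (k : ℤ) :
    fcoef n f k = ∫ t in (0 : ℝ)..1, chr k t • f t := rfl

lemma memLp_int {n : ℕ} {f : ℝ → EuclideanSpace ℂ (Fin n)}
    (hf : MemLp f 2 (volume.restrict (Set.Ioc (0 : ℝ) 1))) :
    IntervalIntegrable f volume 0 1 := by
  rw [intervalIntegrable_iff_integrableOn_Ioc_of_le zero_le_one]
  exact hf.integrable (by norm_num)

lemma memLp_chr_int {n : ℕ} {f : ℝ → EuclideanSpace ℂ (Fin n)} (k : ℤ)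
    (hf : IntervalIntegrable f volume 0 1) :
    IntervalIntegrable (fun t => chr k t • f t) volume 0 1 :=
  hf.continuousOn_smul (chr_cont k).continuousOn

lemma parseval_norm {n : ℕ} {f : ℝ → EuclideanSpace ℂ (Fin n)}
    (hf : MemLp f 2 (volume.restrict (Set.Ioc (0 : ℝ) 1))) :
    HasSum (fun k : ℤ => ‖fcoef n f k‖ ^ 2) (∫ t in (0 : ℝ)..1, ‖f t‖ ^ 2) := by
  have hj : ∀ j : Fin n, MemLp (fun t => f t j) 2 (volume.restrict (Set.Ioc (0 : ℝ) 1)) := fun j =>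
    (EuclideanSpace.proj (𝕜 := ℂ) j).comp_memLp' hf
  have h1 : ∀ j : Fin n, HasSum (fun k : ℤ => ‖fcoef n f k j‖ ^ 2)
      (∫ t in (0 : ℝ)..1, ‖f t j‖ ^ 2) := by
    intro j
    have := hasSum_sq_fourierCoeffOn (zero_lt_one' ℝ) (hj j)
    convert this using 1
    · ext k
      have e : fcoef n f k j = ∫ t in (0 : ℝ)..1, chr k t * f t j := by
        have := (EuclideanSpace.proj (𝕜 := ℂ) j).intervalIntegral_comp_comm
          (memLp_chr_int k (memLp_int hf))
        rw [fcoef_eq]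
        simpa using this.symm
      rw [e, fourierCoeffOn_eq_integral]
      simp only [sub_zero, div_one, one_smul, smul_eq_mul]
      congr 3
      ext t
      rw [fourier_coe_apply]
      unfold chr
      congr 2
      push_cast
      ring
    · simp
  have h2 := hasSum_sum (s := Finset.univ) (fun j _ => h1 j)
  convert h2 using 1
  · ext k; exact EuclideanSpace.norm_sq_eq _
  · rw [← intervalIntegral.integral_finsetSum]
    · simp_rw [EuclideanSpace.norm_sq_eq]
    · intro j _
      rw [intervalIntegrable_iff_integrableOn_Ioc_of_le zero_le_one]
      exact (hj j).integrable_norm_pow (p := 2) (by norm_num)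

lemma re_inner_polar {n : ℕ} (x y : EuclideanSpace ℂ (Fin n)) :
    (⟪x, y⟫_ℂ).re = (‖x + y‖ ^ 2 - ‖x‖ ^ 2 - ‖y‖ ^ 2) / 2 := by
  have := norm_add_sq (𝕜 := ℂ) x y
  simp only [RCLike.re_to_complex] at this
  rw [this]; ring

lemma sq_int {n : ℕ} {f : ℝ → EuclideanSpace ℂ (Fin n)}
    (hf : MemLp f 2 (volume.restrict (Set.Ioc (0 : ℝ) 1))) :
    IntervalIntegrable (fun t => ‖f t‖ ^ 2) volume 0 1 := by
  rw [intervalIntegrable_iff_integrableOn_Ioc_of_le zero_le_one]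
  exact hf.integrable_norm_pow (p := 2) (by norm_num)

lemma inner_int {n : ℕ} {f g : ℝ → EuclideanSpace ℂ (Fin n)}
    (hf : MemLp f 2 (volume.restrict (Set.Ioc (0 : ℝ) 1)))
    (hg : MemLp g 2 (volume.restrict (Set.Ioc (0 : ℝ) 1))) :
    IntervalIntegrable (fun t => (⟪f t, g t⟫_ℂ).re) volume 0 1 := by
  simp_rw [re_inner_polar]
  exact (((sq_int (hf.add hg)).sub (sq_int hf)).sub (sq_int hg)).div_const 2

lemma fcoef_add {n : ℕ} {f g : ℝ → EuclideanSpace ℂ (Fin n)}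
    (hf : MemLp f 2 (volume.restrict (Set.Ioc (0 : ℝ) 1)))
    (hg : MemLp g 2 (volume.restrict (Set.Ioc (0 : ℝ) 1))) (k : ℤ) :
    fcoef n (fun t => f t + g t) k = fcoef n f k + fcoef n g k := by
  simp only [fcoef_eq, smul_add]
  exact intervalIntegral.integral_add (memLp_chr_int k (memLp_int hf))
    (memLp_chr_int k (memLp_int hg))

lemma parseval_inner {n : ℕ} {f g : ℝ → EuclideanSpace ℂ (Fin n)}
    (hf : MemLp f 2 (volume.restrict (Set.Ioc (0 : ℝ) 1)))
    (hg : MemLp g 2 (volume.restrict (Set.Ioc (0 : ℝ) 1))) :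
    HasSum (fun k : ℤ => (⟪fcoef n f k, fcoef n g k⟫_ℂ).re)
      (∫ t in (0 : ℝ)..1, (⟪f t, g t⟫_ℂ).re) := by
  have h := (((parseval_norm (hf.add hg)).sub (parseval_norm hf)).sub (parseval_norm hg)).div_const 2
  have e1 : (fun k : ℤ => (⟪fcoef n f k, fcoef n g k⟫_ℂ).re) = fun k : ℤ =>
      (‖fcoef n (f + g) k‖ ^ 2 - ‖fcoef n f k‖ ^ 2 - ‖fcoef n g k‖ ^ 2) / 2 := by
    ext k
    rw [re_inner_polar, ← fcoef_add hf hg k]; rfl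
  have e2 : (∫ t in (0 : ℝ)..1, (⟪f t, g t⟫_ℂ).re) = (((∫ t in (0 : ℝ)..1, ‖(f + g) t‖ ^ 2) -
      ∫ t in (0 : ℝ)..1, ‖f t‖ ^ 2) - ∫ t in (0 : ℝ)..1, ‖g t‖ ^ 2) / 2 := by
    simp_rw [re_inner_polar]
    rw [intervalIntegral.integral_div, intervalIntegral.integral_sub, intervalIntegral.integral_sub]
    · rfl
    · exact sq_int (hf.add hg)
    · exact sq_int hf
    · exact (sq_int (hf.add hg)).sub (sq_int hf)
    · exact sq_int hg
  rw [e1, e2]; exact h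

lemma fubini_parts {n : ℕ} {u u' : ℝ → ℂ} {g : ℝ → EuclideanSpace ℂ (Fin n)} (hu : ∀ t, HasDerivAt u (u' t) t)
    (hu' : Continuous u') (hg : IntervalIntegrable g volume 0 1) :
    ∫ t in (0 : ℝ)..1, u' t • ∫ s in (0 : ℝ)..t, g s = ∫ s in (0 : ℝ)..1, (u 1 - u s) • g s := by
  set μ := (volume : Measure ℝ).restrict (Ioc (0 : ℝ) 1) with hμ
  have hg' : Integrable g μ := by
    rwa [intervalIntegrable_iff_integrableOn_Ioc_of_le zero_le_one] at hg
  have hui : Integrable u' μ := by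
    have := hu'.intervalIntegrable (μ := volume) 0 1
    rwa [intervalIntegrable_iff_integrableOn_Ioc_of_le zero_le_one] at this
  let F : ℝ → ℝ → EuclideanSpace ℂ (Fin n) := fun t s => ({p : ℝ × ℝ | p.2 ≤ p.1}).indicator
    (fun p => u' p.1 • g p.2) (t, s)
  have hm : MeasurableSet {p : ℝ × ℝ | p.2 ≤ p.1} := measurableSet_le measurable_snd measurable_fst
  have hF : Integrable (Function.uncurry F) (μ.prod μ) := (hui.smul_prod hg').indicator hm
  have hsw := integral_integral_swap hF
  rw [intervalIntegral.integral_of_le zero_le_one, intervalIntegral.integral_of_le zero_le_one]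
  convert hsw using 1
  · refine setIntegral_congr_fun measurableSet_Ioc fun t ht => ?_
    rw [intervalIntegral.integral_of_le ht.1.le, ← integral_smul]
    have : (fun s => F t s) = (Iic t).indicator (fun s => u' t • g s) := by
      ext1 s; simp only [F, indicator_apply, mem_ofPred_eq, mem_Iic]
    rw [this, integral_indicator measurableSet_Iic, hμ, Measure.restrict_restrict measurableSet_Iic]
    congr 2
    ext s; simp only [mem_inter_iff, mem_Iic, mem_Ioc]
    constructor
    · rintro ⟨a, b⟩; exact ⟨b, a, b.trans ht.2⟩
    · rintro ⟨a, b, c⟩; exact ⟨b, a⟩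
  · refine setIntegral_congr_fun measurableSet_Ioc fun s hs => ?_
    have : (fun t => F t s) = (Ici s).indicator (fun t => u' t • g s) := by
      ext1 t; simp only [F, indicator_apply, mem_ofPred_eq, mem_Ici]
    rw [this, integral_indicator measurableSet_Ici, hμ, Measure.restrict_restrict measurableSet_Ici]
    have e : Ici s ∩ Ioc 0 1 = Icc s 1 := by
      ext t; simp only [mem_inter_iff, mem_Ici, mem_Ioc, mem_Icc]
      constructor
      · rintro ⟨a, b, c⟩; exact ⟨a, c⟩
      · rintro ⟨a, b⟩; exact ⟨a, hs.1.trans_le a, b⟩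
    rw [e, integral_Icc_eq_integral_Ioc, ← intervalIntegral.integral_of_le hs.2,
      intervalIntegral.integral_smul_const,
      intervalIntegral.integral_eq_sub_of_hasDerivAt (fun t _ => hu t) (hu'.intervalIntegrable _ _)]

lemma fcoef_deriv {n : ℕ} {β Dβ : ℝ → EuclideanSpace ℂ (Fin n)} (hβper : Function.Periodic β 1)
    (hD : IntervalIntegrable Dβ volume 0 1)
    (hβac : ∀ t : ℝ, β t = β 0 + ∫ s in (0 : ℝ)..t, Dβ s) (k : ℤ) :
    fcoef n Dβ k = (2 * Real.pi * k * Complex.I : ℂ) • fcoef n β k := by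
  have h0 : ∫ s in (0 : ℝ)..1, Dβ s = 0 := by
    have h1 := hβac 1
    have h2 := hβper 0
    rw [zero_add] at h2
    rw [h2] at h1
    simpa using h1
  set c : ℂ := 2 * Real.pi * k * Complex.I with hc
  have hu'c : Continuous (fun t => -c * chr k t) := continuous_const.mul (chr_cont k)
  have hf := fubini_parts (u := chr k) (u' := fun t => -c * chr k t) (g := Dβ)
    (fun t => chr_deriv k t) hu'c hD
  have hcont : ContinuousOn (fun t => ∫ s in (0 : ℝ)..t, Dβ s) (uIcc 0 1) :=
    intervalIntegral.continuousOn_primitive_interval (by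
      rw [uIcc_of_le zero_le_one, integrableOn_Icc_iff_integrableOn_Ioc]
      rwa [intervalIntegrable_iff_integrableOn_Ioc_of_le zero_le_one] at hD)
  have hR : ∫ s in (0 : ℝ)..1, (chr k 1 - chr k s) • Dβ s = - fcoef n Dβ k := by
    simp_rw [sub_smul]
    rw [intervalIntegral.integral_sub (f := fun s => chr k 1 • Dβ s) (hD.smul (chr k 1)) (memLp_chr_int k hD),
      intervalIntegral.integral_smul, h0, smul_zero, zero_sub, fcoef_eq]
  have hL : (-c) • fcoef n β k = ∫ t in (0 : ℝ)..1, (-c * chr k t) • ∫ s in (0 : ℝ)..t, Dβ s := by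
    rw [fcoef_eq, ← intervalIntegral.integral_smul]
    have : ∀ t, (-c) • chr k t • β t =
        (-c * chr k t) • β 0 + (-c * chr k t) • ∫ s in (0 : ℝ)..t, Dβ s := by
      intro t
      rw [← smul_add, ← hβac t, mul_smul]
    simp_rw [this]
    rw [intervalIntegral.integral_add, intervalIntegral.integral_smul_const,
      intervalIntegral.integral_eq_sub_of_hasDerivAt (fun t _ => chr_deriv k t)
      (hu'c.intervalIntegrable _ _), chr_one, chr_zero, sub_self, zero_smul, zero_add]
    · exact (hu'c.smul continuous_const).intervalIntegrable _ _
    · exact (hu'c.continuousOn.smul hcont).intervalIntegrable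
  rw [← hL, hR] at hf
  rw [neg_smul] at hf
  exact (neg_injective hf).symm

lemma taylor_low {φ φ1 φ2 : ℝ → ℝ} {c : ℝ} (h1 : ∀ s, HasDerivAt φ (φ1 s) s)
    (h2 : ∀ s, HasDerivAt φ1 (φ2 s) s) (hc : ∀ s, c ≤ φ2 s) :
    φ 0 + φ1 0 + c / 2 ≤ φ 1 := by
  have d1 : ∀ s, HasDerivAt (fun s => φ1 s - c * s) (φ2 s - c) s := fun s => by
    exact ((h2 s).sub ((hasDerivAt_id s).const_mul c)).congr_deriv (by ring)
  have m1 : Monotone (fun s => φ1 s - c * s) :=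
    monotone_of_deriv_nonneg (fun s => (d1 s).differentiableAt) (fun s => by
      rw [(d1 s).deriv]; linarith [hc s])
  have d2 : ∀ s, HasDerivAt (fun s => φ s - c / 2 * s ^ 2 - φ1 0 * s) (φ1 s - c * s - φ1 0) s :=
    fun s => by
    have := ((h1 s).sub ((hasDerivAt_pow 2 s).const_mul (c / 2))).sub
      ((hasDerivAt_id s).const_mul (φ1 0))
    refine this.congr_deriv ?_
    simp; ring
  have m2 : MonotoneOn (fun s => φ s - c / 2 * s ^ 2 - φ1 0 * s) (Ici 0) :=
    monotoneOn_of_deriv_nonneg (convex_Ici 0)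
      (fun s _ => (d2 s).continuousAt.continuousWithinAt)
      (fun s _ => (d2 s).differentiableAt.differentiableWithinAt) (fun s hs => by
      rw [(d2 s).deriv]
      have hs' : 0 ≤ s := interior_subset hs
      have := m1 hs'
      simp only [mul_zero, sub_zero] at this
      linarith)
  have := m2 (show (0 : ℝ) ∈ Ici 0 from mem_Ici.2 le_rfl) (show (1 : ℝ) ∈ Ici 0 from mem_Ici.2 zero_le_one) zero_le_one
  simp only at this
  nlinarith

lemma H_taylor {n : ℕ} {f : (EuclideanSpace ℂ (Fin n)) → ℝ} (hf : ContDiff ℝ 2 f) {h1 h2 : ℝ}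
    (hq : ∀ z v, h1 * ‖v‖ ^ 2 ≤ iteratedFDeriv ℝ 2 f z ![v, v] ∧
        iteratedFDeriv ℝ 2 f z ![v, v] ≤ h2 * ‖v‖ ^ 2) (z : EuclideanSpace ℂ (Fin n)) :
    f 0 + fderiv ℝ f 0 z + h1 / 2 * ‖z‖ ^ 2 ≤ f z ∧
    f z ≤ f 0 + fderiv ℝ f 0 z + h2 / 2 * ‖z‖ ^ 2 := by
  have l : ∀ s : ℝ, HasDerivAt (fun s : ℝ => s • z) z s := fun s => by
    simpa using (hasDerivAt_id s).smul_const z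
  have e1 : ∀ s : ℝ, HasDerivAt (fun s : ℝ => f (s • z)) (fderiv ℝ f (s • z) z) s := fun s =>
    ((hf.differentiable (by norm_num)) (s • z)).hasFDerivAt.comp_hasDerivAt s (l s)
  have hf1 : ContDiff ℝ 1 (fderiv ℝ f) := hf.fderiv_right (by norm_num)
  have e2 : ∀ s : ℝ, HasDerivAt (fun s : ℝ => fderiv ℝ f (s • z) z)
      (iteratedFDeriv ℝ 2 f (s • z) ![z, z]) s := fun s => by
    have h := ((hf1.differentiable (by norm_num)) (s • z)).hasFDerivAt.comp_hasDerivAt s (l s)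
    have := h.clm_apply (hasDerivAt_const s z)
    rw [iteratedFDeriv_two_apply]
    simpa using this
  have a := taylor_low e1 e2 (fun s => (hq (s • z) z).1)
  have b := taylor_low (fun s => (e1 s).neg) (fun s => (e2 s).neg)
    (fun s => neg_le_neg (hq (s • z) z).2)
  simp at a b
  constructor <;> linarith

lemma H_slice {n : ℕ} {H : ℝ → (EuclideanSpace ℂ (Fin n)) → ℝ}
    (hs : ContDiff ℝ (⊤ : ℕ∞) (fun p : ℝ × (EuclideanSpace ℂ (Fin n)) => H p.1 p.2)) (t : ℝ) :
    ContDiff ℝ 2 (H t) := by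
  have : ContDiff ℝ 2 (fun p : ℝ × (EuclideanSpace ℂ (Fin n)) => H p.1 p.2) := by exact_mod_cast contDiff_infty.1 hs 2
  exact this.comp (contDiff_const.prodMk contDiff_id)

lemma H_K {n : ℕ} {H : ℝ → (EuclideanSpace ℂ (Fin n)) → ℝ}
    (hs : ContDiff ℝ (⊤ : ℕ∞) (fun p : ℝ × (EuclideanSpace ℂ (Fin n)) => H p.1 p.2)) :
    ∃ K : ℝ, 0 ≤ K ∧ ∀ t ∈ Icc (0 : ℝ) 1, |H t 0| ≤ K ∧ ‖fderiv ℝ (H t) 0‖ ≤ K := by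
  have h2 : ContDiff ℝ 2 (fun p : ℝ × (EuclideanSpace ℂ (Fin n)) => H p.1 p.2) := by exact_mod_cast contDiff_infty.1 hs 2
  have c1 : Continuous (fun t => H t 0) :=
    h2.continuous.comp (continuous_id.prodMk continuous_const)
  have c2 : Continuous (fun t => fderiv ℝ (H t) 0) := by
    have e : ∀ t, fderiv ℝ (H t) 0 = (fderiv ℝ (fun p : ℝ × (EuclideanSpace ℂ (Fin n)) => H p.1 p.2) (t, 0)).comp
        (ContinuousLinearMap.inr ℝ ℝ (EuclideanSpace ℂ (Fin n))) := by
      intro t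
      have a := ((h2.differentiable (by norm_num)) (t, (0 : EuclideanSpace ℂ (Fin n)))).hasFDerivAt
      exact (a.comp (0 : EuclideanSpace ℂ (Fin n)) (hasFDerivAt_prodMk_right t (0 : EuclideanSpace ℂ (Fin n)))).fderiv
    simp_rw [e]
    have c3 : Continuous (fderiv ℝ (fun p : ℝ × (EuclideanSpace ℂ (Fin n)) => H p.1 p.2)) :=
      h2.continuous_fderiv (by norm_num)
    exact (c3.comp (continuous_id.prodMk continuous_const)).clm_comp continuous_const
  obtain ⟨A, hA⟩ := isCompact_Icc.exists_bound_of_continuousOn (s := Icc (0 : ℝ) 1) c1.continuousOn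
  obtain ⟨B, hB⟩ := isCompact_Icc.exists_bound_of_continuousOn (s := Icc (0 : ℝ) 1) c2.continuousOn
  refine ⟨max 0 (max A B), le_max_left _ _, fun t ht => ⟨?_, ?_⟩⟩
  · exact (hA t ht).trans ((le_max_left _ _).trans (le_max_right _ _))
  · exact (hB t ht).trans ((le_max_right _ _).trans (le_max_right _ _))

lemma conj_bound {n : ℕ} {f : (EuclideanSpace ℂ (Fin n)) → ℝ} {L : (EuclideanSpace ℂ (Fin n)) →L[ℝ] ℝ} {h1 : ℝ} (h0 : 0 < h1)
    (hf : ∀ z, f 0 + L z + h1 / 2 * ‖z‖ ^ 2 ≤ f z) (w z : EuclideanSpace ℂ (Fin n)) :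
    (⟪z, w⟫_ℂ).re - f z ≤ (‖w‖ + ‖L‖) ^ 2 / (2 * h1) - f 0 := by
  have a : (⟪z, w⟫_ℂ).re ≤ ‖z‖ * ‖w‖ := by
    have := re_inner_le_norm (𝕜 := ℂ) z w
    simpa using this
  have b : -(‖L‖ * ‖z‖) ≤ L z := by
    have := L.le_opNorm z
    rw [Real.norm_eq_abs] at this
    linarith [neg_abs_le (L z)]
  have c := hf z
  have d : (‖w‖ + ‖L‖) * ‖z‖ - h1 / 2 * ‖z‖ ^ 2 ≤ (‖w‖ + ‖L‖) ^ 2 / (2 * h1) := by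
    rw [le_div_iff₀ (by positivity)]
    nlinarith [sq_nonneg (‖w‖ + ‖L‖ - h1 * ‖z‖)]
  nlinarith

lemma H_int {n : ℕ} {H : ℝ → (EuclideanSpace ℂ (Fin n)) → ℝ}
    (hs : ContDiff ℝ (⊤ : ℕ∞) (fun p : ℝ × (EuclideanSpace ℂ (Fin n)) => H p.1 p.2)) {h1 h2 : ℝ} (h10 : 0 < h1)
    (h12 : h1 ≤ h2)
    (hq : ∀ t z v, h1 * ‖v‖ ^ 2 ≤ iteratedFDeriv ℝ 2 (H t) z ![v, v] ∧
        iteratedFDeriv ℝ 2 (H t) z ![v, v] ≤ h2 * ‖v‖ ^ 2)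
    {g : ℝ → EuclideanSpace ℂ (Fin n)} (hg : MemLp g 2 (volume.restrict (Set.Ioc (0 : ℝ) 1))) :
    IntervalIntegrable (fun t => H t (g t)) volume 0 1 := by
  obtain ⟨K, hK0, hK⟩ := H_K hs
  have hb : IntervalIntegrable (fun t => 2 * K + (K + h2) * ‖g t‖ ^ 2) volume 0 1 :=
    intervalIntegrable_const.add ((sq_int hg).const_mul _)
  rw [intervalIntegrable_iff_integrableOn_Ioc_of_le zero_le_one] at hb ⊢
  refine Integrable.mono' hb ?_ ?_
  · exact hs.continuous.comp_aestronglyMeasurable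
      (aestronglyMeasurable_id.prodMk hg.aestronglyMeasurable)
  · refine (ae_restrict_mem measurableSet_Ioc).mono fun t ht => ?_
    obtain ⟨k1, k2⟩ := hK t ⟨ht.1.le, ht.2⟩
    obtain ⟨u, v⟩ := H_taylor (H_slice hs t) (hq t) (g t)
    have b : |fderiv ℝ (H t) 0 (g t)| ≤ K * ‖g t‖ :=
      ((fderiv ℝ (H t) 0).le_opNorm (g t)).trans
        (mul_le_mul_of_nonneg_right k2 (norm_nonneg _))
    have b2 : K * ‖g t‖ ≤ K * (1 + ‖g t‖ ^ 2) :=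
      mul_le_mul_of_nonneg_left (by nlinarith [sq_nonneg (‖g t‖ - 1), norm_nonneg (g t)]) hK0
    have p1 := mul_nonneg h10.le (sq_nonneg ‖g t‖)
    have p2 := mul_nonneg (h10.le.trans h12) (sq_nonneg ‖g t‖)
    rw [Real.norm_eq_abs]
    rw [abs_le] at *
    constructor <;> nlinarith

lemma conj_int {n : ℕ} {H : ℝ → (EuclideanSpace ℂ (Fin n)) → ℝ}
    (hs : ContDiff ℝ (⊤ : ℕ∞) (fun p : ℝ × (EuclideanSpace ℂ (Fin n)) => H p.1 p.2)) {h1 h2 : ℝ} (h10 : 0 < h1)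
    (hq : ∀ t z v, h1 * ‖v‖ ^ 2 ≤ iteratedFDeriv ℝ 2 (H t) z ![v, v] ∧
        iteratedFDeriv ℝ 2 (H t) z ![v, v] ≤ h2 * ‖v‖ ^ 2)
    {g : ℝ → EuclideanSpace ℂ (Fin n)} (hg : MemLp g 2 (volume.restrict (Set.Ioc (0 : ℝ) 1))) :
    (∀ t w, BddAbove (range fun z => (⟪z, w⟫_ℂ).re - H t z)) ∧
    IntervalIntegrable (fun t => ⨆ z, ((⟪z, g t⟫_ℂ).re - H t z)) volume 0 1 := by
  obtain ⟨K, hK0, hK⟩ := H_K hs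
  have key : ∀ t w z, (⟪z, w⟫_ℂ).re - H t z ≤
      (‖w‖ + ‖fderiv ℝ (H t) 0‖) ^ 2 / (2 * h1) - H t 0 := fun t w z =>
    conj_bound h10 (fun z => (H_taylor (H_slice hs t) (hq t) z).1) w z
  have bdd : ∀ t w, BddAbove (range fun z => (⟪z, w⟫_ℂ).re - H t z) := fun t w =>
    ⟨_, by rintro _ ⟨z, rfl⟩; exact key t w z⟩
  refine ⟨bdd, ?_⟩
  have lsc : LowerSemicontinuous (fun p : ℝ × (EuclideanSpace ℂ (Fin n)) => ⨆ z, ((⟪z, p.2⟫_ℂ).re - H p.1 z)) := by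
    refine lowerSemicontinuous_ciSup (fun p => bdd p.1 p.2) (fun z => Continuous.lowerSemicontinuous ?_)
    have : Continuous (fun p : ℝ × (EuclideanSpace ℂ (Fin n)) => H p.1 z) :=
      hs.continuous.comp (continuous_fst.prodMk continuous_const)
    have c : Continuous (fun p : ℝ × (EuclideanSpace ℂ (Fin n)) => ⟪z, p.2⟫_ℂ) := continuous_const.inner continuous_snd
    exact (Complex.continuous_re.comp c).sub this
  have hb : IntervalIntegrable (fun t => (‖g t‖ ^ 2 + K ^ 2) / h1 + K) volume 0 1 :=
    (((sq_int hg).add intervalIntegrable_const).div_const _).add intervalIntegrable_const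
  rw [intervalIntegrable_iff_integrableOn_Ioc_of_le zero_le_one] at hb ⊢
  refine Integrable.mono' hb ?_ ?_
  · exact (lsc.measurable.comp_aemeasurable
      (aemeasurable_id.prodMk hg.aestronglyMeasurable.aemeasurable)).aestronglyMeasurable
  · refine (ae_restrict_mem measurableSet_Ioc).mono fun t ht => ?_
    obtain ⟨k1, k2⟩ := hK t ⟨ht.1.le, ht.2⟩
    rw [abs_le] at k1
    have q : 0 ≤ (‖g t‖ ^ 2 + K ^ 2) / h1 := by positivity
    rw [Real.norm_eq_abs, abs_le]
    constructor
    · have := le_ciSup (bdd t (g t)) 0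
      simp only [inner_zero_left, Complex.zero_re] at this
      linarith
    · refine ciSup_le fun z => (key t (g t) z).trans ?_
      have : (‖g t‖ + ‖fderiv ℝ (H t) 0‖) ^ 2 / (2 * h1) ≤ (‖g t‖ ^ 2 + K ^ 2) / h1 := by
        rw [div_le_div_iff₀ (by positivity) h10]
        have : (‖g t‖ + ‖fderiv ℝ (H t) 0‖) ^ 2 ≤ 2 * (‖g t‖ ^ 2 + K ^ 2) := by
          nlinarith [sq_nonneg (‖g t‖ - ‖fderiv ℝ (H t) 0‖), norm_nonneg (fderiv ℝ (H t) 0)]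
        nlinarith
      linarith

/-- The fundamental inequality of Clarke duality, inequality (9.1) = `\eqref{ines}` of the
paper: for a quadratically convex Hamiltonian `H`, a loop `β` of class `H¹` (absolutely
continuous with `L²` derivative `Dβ`) and a perturbation `η ∈ H^{1/2}` with only
nonpositive-frequency Fourier modes, the Hamiltonian action of `γ = β + η` is bounded by
the Clarke dual action of `β` minus half the squared `H^{1/2}`-norm of the negative
frequency part of `η`. -/
theorem stmt11 (n : ℕ) (hn : 1 ≤ n)
    (H : ℝ → EuclideanSpace ℂ (Fin n) → ℝ)
    (hsmooth : ContDiff ℝ (⊤ : ℕ∞) (fun p : ℝ × EuclideanSpace ℂ (Fin n) => H p.1 p.2))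
    (hper : ∀ t z, H (t + 1) z = H t z)
    (hquad : ∃ h1 h2 : ℝ, 0 < h1 ∧ h1 ≤ h2 ∧
      ∀ t z v, h1 * ‖v‖ ^ 2 ≤ iteratedFDeriv ℝ 2 (H t) z ![v, v] ∧
        iteratedFDeriv ℝ 2 (H t) z ![v, v] ≤ h2 * ‖v‖ ^ 2)
    (β Dβ : ℝ → EuclideanSpace ℂ (Fin n))
    (hβper : Function.Periodic β 1)
    (hDβper : Function.Periodic Dβ 1)
    (hDβL2 : MemLp Dβ 2 (volume.restrict (Set.Ioc (0 : ℝ) 1)))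
    (hβac : ∀ t : ℝ, β t = β 0 + ∫ s in (0 : ℝ)..t, Dβ s)
    (η : ℝ → EuclideanSpace ℂ (Fin n))
    (hηper : Function.Periodic η 1)
    (hηL2 : MemLp η 2 (volume.restrict (Set.Ioc (0 : ℝ) 1)))
    (hηpos : ∀ k : ℤ, 1 ≤ k → fcoef n η k = 0)
    (hηsum : Summable fun k : ℤ => |(k : ℝ)| * ‖fcoef n η k‖ ^ 2)
    (hγsum : Summable fun k : ℤ => |(k : ℝ)| * ‖fcoef n (fun t => β t + η t) k‖ ^ 2)
    (hβsum : Summable fun k : ℤ => |(k : ℝ)| * ‖fcoef n β k‖ ^ 2) :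
    Real.pi * (∑' k : ℤ, (k : ℝ) * ‖fcoef n (fun t => β t + η t) k‖ ^ 2) -
        (∫ t in (0 : ℝ)..1, H t (β t + η t)) ≤
      -(Real.pi * ∑' k : ℤ, (k : ℝ) * ‖fcoef n β k‖ ^ 2) +
        (∫ t in (0 : ℝ)..1, ⨆ z, ((⟪z, -(Complex.I • Dβ t)⟫_ℂ).re - H t z)) -
        Real.pi * ∑' k : ℤ, (if k ≤ -1 then |(k : ℝ)| * ‖fcoef n η k‖ ^ 2 else 0) := by
  obtain ⟨h1, h2, h10, h12, hq⟩ := hquad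
  have hDint := memLp_int hDβL2
  have hβL2 : MemLp β 2 (volume.restrict (Set.Ioc (0 : ℝ) 1)) := by
    have hcont : ContinuousOn (fun t => ∫ s in (0 : ℝ)..t, Dβ s) (uIcc 0 1) :=
      intervalIntegral.continuousOn_primitive_interval (by
        rw [uIcc_of_le zero_le_one, integrableOn_Icc_iff_integrableOn_Ioc]
        rwa [intervalIntegrable_iff_integrableOn_Ioc_of_le zero_le_one] at hDint)
    have hc : ContinuousOn β (Icc 0 1) := by
      rw [uIcc_of_le zero_le_one] at hcont
      exact (continuousOn_const.add hcont).congr (fun t _ => hβac t)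
    obtain ⟨C, hC⟩ := isCompact_Icc.exists_bound_of_continuousOn hc
    exact MemLp.of_bound ((hc.mono Ioc_subset_Icc_self).aestronglyMeasurable measurableSet_Ioc) C
      ((ae_restrict_mem measurableSet_Ioc).mono fun t ht => hC t (Ioc_subset_Icc_self ht))
  have hγL2 : MemLp (fun t => β t + η t) 2 (volume.restrict (Set.Ioc (0 : ℝ) 1)) := hβL2.add hηL2
  have hwL2 : MemLp (fun t => -(Complex.I • Dβ t)) 2 (volume.restrict (Set.Ioc (0 : ℝ) 1)) :=
    (hDβL2.const_smul Complex.I).neg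
  have hHint := H_int hsmooth h10 h12 hq hγL2
  obtain ⟨bdd, hCint⟩ := conj_int hsmooth h10 hq hwL2
  have hmono : ∫ t in (0 : ℝ)..1, (⟪β t + η t, -(Complex.I • Dβ t)⟫_ℂ).re ≤
      (∫ t in (0 : ℝ)..1, ⨆ z, ((⟪z, -(Complex.I • Dβ t)⟫_ℂ).re - H t z)) +
      ∫ t in (0 : ℝ)..1, H t (β t + η t) := by
    rw [← intervalIntegral.integral_add hCint hHint]
    refine intervalIntegral.integral_mono_on zero_le_one (inner_int hγL2 hwL2)
      (hCint.add hHint) fun t _ => ?_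
    have := le_ciSup (bdd t (-(Complex.I • Dβ t))) (β t + η t)
    linarith
  have hw : ∀ k, fcoef n (fun t => -(Complex.I • Dβ t)) k =
      ((2 * Real.pi * k : ℝ) : ℂ) • fcoef n β k := by
    intro k
    have e : fcoef n (fun t => -(Complex.I • Dβ t)) k = (-Complex.I) • fcoef n Dβ k := by
      rw [fcoef_eq, fcoef_eq, ← intervalIntegral.integral_smul]
      congr 1
      ext1 t
      rw [← neg_smul, smul_comm]
    rw [e, fcoef_deriv hβper hDint hβac k, smul_smul]
    congr 1
    push_cast
    linear_combination (-(2 * Real.pi * k) : ℂ) * Complex.I_mul_I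
  have hpar := parseval_inner hγL2 hwL2
  have hγs : Summable fun k : ℤ => (k : ℝ) * ‖fcoef n (fun t => β t + η t) k‖ ^ 2 :=
    Summable.of_norm (by simpa [abs_mul] using hγsum)
  have hβs : Summable fun k : ℤ => (k : ℝ) * ‖fcoef n β k‖ ^ 2 :=
    Summable.of_norm (by simpa [abs_mul] using hβsum)
  have hηs : Summable fun k : ℤ => (if k ≤ -1 then |(k : ℝ)| * ‖fcoef n η k‖ ^ 2 else 0) :=
    Summable.of_nonneg_of_le (fun k => by split_ifs <;> positivity)
      (fun k => by split_ifs <;> first | exact le_rfl | positivity) hηsum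
  have hsum := ((hγs.hasSum.add hβs.hasSum).add hηs.hasSum).mul_left Real.pi
  have heq : (fun k : ℤ => (⟪fcoef n (fun t => β t + η t) k,
      fcoef n (fun t => -(Complex.I • Dβ t)) k⟫_ℂ).re) = fun k : ℤ =>
      Real.pi * ((k : ℝ) * ‖fcoef n (fun t => β t + η t) k‖ ^ 2 + (k : ℝ) * ‖fcoef n β k‖ ^ 2 +
        (if k ≤ -1 then |(k : ℝ)| * ‖fcoef n η k‖ ^ 2 else 0)) := by
    ext k
    rw [hw k, inner_smul_right, Complex.re_ofReal_mul, fcoef_add hβL2 hηL2 k]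
    have e1 : (if k ≤ -1 then |(k : ℝ)| * ‖fcoef n η k‖ ^ 2 else 0) =
        -((k : ℝ) * ‖fcoef n η k‖ ^ 2) := by
      split_ifs with hk
      · rw [abs_of_nonpos (by exact_mod_cast (by omega : k ≤ 0))]; ring
      · rcases eq_or_ne k 0 with rfl | h0
        · simp
        · rw [hηpos k (by omega)]; simp
    have e2 : (⟪fcoef n β k + fcoef n η k, fcoef n β k⟫_ℂ).re =
        ‖fcoef n β k‖ ^ 2 + (⟪fcoef n β k, fcoef n η k⟫_ℂ).re := by
      rw [inner_add_left, Complex.add_re]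
      have a := inner_self_eq_norm_sq (𝕜 := ℂ) (fcoef n β k)
      have b := inner_re_symm (𝕜 := ℂ) (fcoef n β k) (fcoef n η k)
      simp only [RCLike.re_to_complex] at a b
      rw [a, b]
    rw [e1, e2, re_inner_polar]
    ring
  rw [heq] at hpar
  have hfin := hpar.unique hsum
  rw [hfin] at hmono
  linarith
end
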